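/- arXiv:0710.4032 — 2 statements merged into one kernel-verified Lean document; each statement's English description precedes it below -/
import Mathlib

section
/- For every positive integer k, ∫_0^1 log Γ(x) · sin(2kπx) dx = (γ + log(2kπ))/(2kπ). -/
open Real Set Filter Topology MeasureTheory
open scoped FourierTransform

lemma one_sub_cos_two_mul_div (c x : ℝ) (hc : c ≠ 0) :
    (1 - cos (2 * c * x)) / x = 2 * c * (sinc (c * x) * sin (c * x)) := by
  rcases eq_or_ne x 0 with rfl | hx
  · simp
  · rw [sinc_of_ne_zero (mul_ne_zero hc hx), mul_assoc 2 c x, cos_two_mul, cos_sq']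
    field_simp
    ring

lemma continuous_one_sub_cos_div (c : ℝ) : Continuous fun x : ℝ => (1 - cos (c * x)) / x := by
  rcases eq_or_ne c 0 with rfl | hc
  · simpa using continuous_const
  · have h : (fun x : ℝ => (1 - cos (c * x)) / x) =
        fun x => 2 * (c / 2) * (sinc (c / 2 * x) * sin (c / 2 * x)) := by
      funext x
      rw [← one_sub_cos_two_mul_div _ _ (by positivity), mul_div_cancel₀ c two_ne_zero]
    rw [h]
    fun_prop

lemma continuous_log_mul_one_sub_cos (c : ℝ) :
    Continuous fun x : ℝ => log x * (1 - cos (c * x)) := by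
  have h : (fun x : ℝ => log x * (1 - cos (c * x))) =
      fun x => (x * log x) * ((1 - cos (c * x)) / x) := by
    funext x
    rcases eq_or_ne x 0 with rfl | hx
    · simp
    · field_simp
  rw [h]
  exact continuous_mul_log.mul (continuous_one_sub_cos_div c)

lemma intervalIntegrable_log_mul_sin (c a b : ℝ) :
    IntervalIntegrable (fun x => log x * sin (c * x)) volume a b :=
  intervalIntegral.intervalIntegrable_log'.mul_continuousOn (by fun_prop)

/-- Integration by parts for `log x * sin (c x)`. -/
lemma integral_log_mul_sin {c b : ℝ} (hc : c ≠ 0) (hb : 0 ≤ b) :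
    ∫ x in (0 : ℝ)..b, log x * sin (c * x) =
      (log b * (1 - cos (c * b)) - ∫ x in (0 : ℝ)..b, (1 - cos (c * x)) / x) / c := by
  have hi := (continuous_one_sub_cos_div c).intervalIntegrable (μ := volume) 0 b
  have hl := intervalIntegrable_log_mul_sin c 0 b
  have h := intervalIntegral.integral_eq_sub_of_hasDerivAt_of_le hb
    (continuous_log_mul_one_sub_cos c).continuousOn
    (f' := fun x => (1 - cos (c * x)) / x + c * (log x * sin (c * x)))
    (fun x hx => by
      have h1 := (hasDerivAt_log hx.1.ne').mul
        (((hasDerivAt_id x).const_mul c).cos.const_sub 1)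
      refine h1.congr_deriv ?_
      simp only [id]
      ring)
    (hi.add (hl.const_mul c))
  rw [intervalIntegral.integral_add hi (hl.const_mul c),
    intervalIntegral.integral_const_mul] at h
  rw [eq_div_iff hc]
  simp only [mul_zero, cos_zero, sub_self] at h
  linarith

lemma two_mul_sum_sin_odd_mul_sin (n : ℕ) (t : ℝ) :
    2 * (∑ j ∈ Finset.range n, sin ((2 * j + 1) * t)) * sin t = 1 - cos (2 * n * t) := by
  induction n with
  | zero => simp
  | succ n ih =>
    rw [Finset.sum_range_succ, mul_add, add_mul, ih]
    have h1 : 2 * (n : ℝ) * t = (2 * n + 1) * t - t := by ring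
    have h2 : 2 * ((n + 1 : ℕ) : ℝ) * t = (2 * n + 1) * t + t := by push_cast; ring
    rw [h1, h2, cos_sub, cos_add]
    ring

lemma one_sub_cos_div_sin {t : ℝ} (n : ℕ) (ht : t ∈ Icc 0 (π / 2)) :
    (1 - cos (2 * n * t)) / sin t = 2 * ∑ j ∈ Finset.range n, sin ((2 * j + 1) * t) := by
  rcases eq_or_lt_of_le ht.1 with rfl | h0
  · simp
  · have := sin_pos_of_pos_of_lt_pi h0 (by linarith [ht.2, pi_pos])
    rw [← two_mul_sum_sin_odd_mul_sin, mul_div_cancel_right₀ _ this.ne']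

lemma integral_sin_odd (j : ℕ) :
    ∫ t in (0 : ℝ)..(π / 2), sin ((2 * j + 1) * t) = 1 / (2 * j + 1) := by
  have h : (2 * (j : ℝ) + 1) ≠ 0 := by positivity
  have hc : cos ((2 * (j : ℝ) + 1) * (π / 2)) = 0 := by
    rw [cos_eq_zero_iff]
    exact ⟨j, by push_cast; ring⟩
  rw [intervalIntegral.integral_comp_mul_left (fun x => sin x) h]
  simp [integral_sin, hc]

lemma intervalIntegrable_one_sub_cos_div_sin (n : ℕ) :
    IntervalIntegrable (fun t => (1 - cos (2 * n * t)) / sin t) volume 0 (π / 2) := by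
  have h : Continuous fun t : ℝ => 2 * ∑ j ∈ Finset.range n, sin ((2 * (j : ℝ) + 1) * t) := by
    fun_prop
  refine (h.intervalIntegrable 0 (π / 2)).congr fun t ht => ?_
  rw [uIoc_of_le (by positivity)] at ht
  exact (one_sub_cos_div_sin n ⟨ht.1.le, ht.2⟩).symm

lemma integral_one_sub_cos_div_sin (n : ℕ) :
    ∫ t in (0 : ℝ)..(π / 2), (1 - cos (2 * n * t)) / sin t =
      2 * (harmonic (2 * n) : ℝ) - harmonic n := by
  have h1 : ∫ t in (0 : ℝ)..(π / 2), (1 - cos (2 * n * t)) / sin t =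
      ∫ t in (0 : ℝ)..(π / 2), 2 * ∑ j ∈ Finset.range n, sin ((2 * (j : ℝ) + 1) * t) := by
    refine intervalIntegral.integral_congr fun t ht => ?_
    rw [uIcc_of_le (by positivity)] at ht
    exact one_sub_cos_div_sin n ht
  rw [h1, intervalIntegral.integral_const_mul, intervalIntegral.integral_finsetSum
    (fun j _ => Continuous.intervalIntegrable (by fun_prop) _ _)]
  simp_rw [integral_sin_odd]
  clear h1
  induction n with
  | zero => simp
  | succ n ih =>
    rw [Finset.sum_range_succ, mul_add, ih, show 2 * (n + 1) = 2 * n + 1 + 1 by ring,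
      harmonic_succ, harmonic_succ, harmonic_succ]
    push_cast
    field_simp
    ring

/-- An antiderivative of `1 / sin t - 1 / t`, continuous at `0`. -/
lemma hasDerivAt_log_sinc_sub_log_cos {t : ℝ} (ht : t ∈ Ioo 0 (π / 2)) :
    HasDerivAt (fun t => log (sinc (t / 2)) - log (cos (t / 2))) (1 / sin t - 1 / t) t := by
  have ht0 : t ≠ 0 := ht.1.ne'
  have hs : 0 < sin (t / 2) :=
    sin_pos_of_pos_of_lt_pi (by linarith [ht.1]) (by linarith [ht.2, pi_pos])
  have hc : 0 < cos (t / 2) :=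
    cos_pos_of_mem_Ioo ⟨by linarith [ht.1, pi_pos], by linarith [ht.2, pi_pos]⟩
  have hd : HasDerivAt (fun t : ℝ => t / 2) (1 / 2) t := (hasDerivAt_id t).div_const 2
  have h1 : HasDerivAt (fun t => log (sin (t / 2) / (t / 2)) - log (cos (t / 2)))
      (1 / sin t - 1 / t) t := by
    refine (((hd.sin.div hd (by positivity)).log (div_pos hs (half_pos ht.1)).ne').sub
      (hd.cos.log hc.ne')).congr_deriv ?_
    have h2 : sin t = 2 * sin (t / 2) * cos (t / 2) := by rw [← sin_two_mul]; ring_nf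
    rw [h2]
    simp only [Pi.div_apply]
    field_simp
    have := sin_sq_add_cos_sq (t / 2)
    grind
  refine h1.congr_of_eventuallyEq ?_
  filter_upwards [eventually_ne_nhds ht0] with y hy
  rw [sinc_of_ne_zero (by positivity)]

lemma continuousOn_log_sinc_sub_log_cos :
    ContinuousOn (fun t => log (sinc (t / 2)) - log (cos (t / 2))) (Icc 0 (π / 2)) := by
  refine (ContinuousOn.log (by fun_prop) fun t ht => ?_).sub
    (ContinuousOn.log (by fun_prop) fun t ht => ?_)
  · rcases eq_or_lt_of_le ht.1 with rfl | h0
    · simp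
    · rw [sinc_of_ne_zero (by positivity)]
      have : 0 < sin (t / 2) :=
        sin_pos_of_pos_of_lt_pi (by linarith) (by linarith [ht.2, pi_pos])
      positivity
  · exact (cos_pos_of_mem_Ioo ⟨by linarith [ht.1, pi_pos], by linarith [ht.2, pi_pos]⟩).ne'

lemma intervalIntegrable_one_div_sin_sub_one_div :
    IntervalIntegrable (fun t => 1 / sin t - 1 / t) volume 0 (π / 2) := by
  have h0 : (0 : ℝ) ≤ π / 2 := by positivity
  refine intervalIntegral.intervalIntegrable_deriv_of_nonneg
    (g := fun t => log (sinc (t / 2)) - log (cos (t / 2))) ?_ ?_ ?_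
  · rw [uIcc_of_le h0]
    exact continuousOn_log_sinc_sub_log_cos
  · rw [min_eq_left h0, max_eq_right h0]
    exact fun t ht => hasDerivAt_log_sinc_sub_log_cos ht
  · rw [min_eq_left h0, max_eq_right h0]
    intro t ht
    exact sub_nonneg.2 (one_div_le_one_div_of_le
      (sin_pos_of_pos_of_lt_pi ht.1 (by linarith [ht.2, pi_pos])) (sin_le ht.1.le))

lemma integral_one_div_sin_sub_one_div :
    ∫ t in (0 : ℝ)..(π / 2), (1 / sin t - 1 / t) = log 4 - log π := by
  rw [intervalIntegral.integral_eq_sub_of_hasDerivAt_of_le (by positivity)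
    continuousOn_log_sinc_sub_log_cos (fun t ht => hasDerivAt_log_sinc_sub_log_cos ht)
    intervalIntegrable_one_div_sin_sub_one_div]
  have h : π / 2 / 2 = π / 4 := by ring
  rw [h, sinc_of_ne_zero (by positivity), sin_pi_div_four, cos_pi_div_four,
    log_div (by positivity) (by positivity), log_div pi_ne_zero (by positivity)]
  simp

/-- Riemann–Lebesgue lemma for cosine coefficients. -/
lemma tendsto_integral_mul_cos {f : ℝ → ℝ} {a b : ℝ} (hab : a ≤ b)
    (hf : IntervalIntegrable f volume a b) :
    Tendsto (fun w : ℝ => ∫ t in a..b, f t * cos (w * t)) atTop (𝓝 0) := by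
  have h := (Real.tendsto_integral_exp_smul_cocompact
    ((Ioc a b).indicator fun t => (f t : ℂ))).comp
      ((tendsto_id.atTop_div_const (r := 2 * π) (by positivity)).mono_right atTop_le_cocompact)
  have h' := (Complex.continuous_re.tendsto _).comp h
  rw [Complex.zero_re] at h'
  refine h'.congr fun w => ?_
  have hfi : Integrable ((Ioc a b).indicator fun t => (f t : ℂ)) := by
    rw [integrable_indicator_iff measurableSet_Ioc]
    exact ((intervalIntegrable_iff_integrableOn_Ioc_of_le hab).1 hf).ofReal
  have hint := (Real.fourierIntegral_convergent_iff (w / (2 * π))).2 hfi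
  have hre := integral_re hint
  simp only [Function.comp_apply, id]
  rw [intervalIntegral.integral_of_le hab, ← integral_indicator measurableSet_Ioc]
  refine Eq.trans (Eq.trans ?_ hre.symm) ?_
  · simp [mul_comm]
  congr 1 with v
  by_cases hv : v ∈ Ioc a b
  · have harg : 2 * π * -(inner ℝ v (w / (2 * π))) = -(w * v) := by
      simp only [RCLike.inner_apply, conj_trivial]
      field_simp
    simp only [indicator_of_mem hv, Circle.smul_def, fourierChar_apply, smul_eq_mul,
      RCLike.re_eq_complex_re, Complex.re_mul_ofReal, Complex.exp_ofReal_mul_I_re]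
    rw [harg, cos_neg, mul_comm]
  · simp [hv]

lemma integral_one_sub_cos_div (n : ℕ) :
    ∫ t in (0 : ℝ)..(π / 2), (1 - cos (2 * n * t)) / t =
      2 * (harmonic (2 * n) : ℝ) - harmonic n - (log 4 - log π) +
        ∫ t in (0 : ℝ)..(π / 2), (1 / sin t - 1 / t) * cos (2 * n * t) := by
  have hg := intervalIntegrable_one_div_sin_sub_one_div
  have hgc : IntervalIntegrable (fun t => (1 / sin t - 1 / t) * cos (2 * n * t)) volume 0 (π / 2) :=
    hg.mul_continuousOn (by fun_prop)
  have hs := intervalIntegrable_one_sub_cos_div_sin n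
  rw [← integral_one_sub_cos_div_sin, ← integral_one_div_sin_sub_one_div,
    ← intervalIntegral.integral_sub hs hg, ← intervalIntegral.integral_add (hs.sub hg) hgc]
  congr 1 with t
  ring

/-- The logarithmic asymptotics of the entire cosine integral along integer multiples of `π`. -/
lemma tendsto_integral_one_sub_cos_div_sub_log :
    Tendsto (fun n : ℕ => (∫ t in (0 : ℝ)..(π / 2), (1 - cos (2 * n * t)) / t) - log n) atTop
      (𝓝 (eulerMascheroniConstant + log π)) := by
  have hH := tendsto_harmonic_sub_log
  have h2 : Tendsto (fun n : ℕ => 2 * n) atTop atTop := tendsto_id.const_mul_atTop' two_pos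
  have hH2 := hH.comp h2
  have hRL := (tendsto_integral_mul_cos (by positivity)
    intervalIntegrable_one_div_sin_sub_one_div).comp
      (tendsto_natCast_atTop_atTop.const_mul_atTop (two_pos (α := ℝ)))
  have h := ((((hH2.const_mul 2).sub hH).add_const (2 * log 2)).sub_const (log 4 - log π)).add hRL
  have h4 : log 4 = 2 * log 2 := by
    rw [show (4 : ℝ) = 2 ^ 2 by norm_num, log_pow]; norm_num
  refine (h.congr' ?_).trans_eq ?_
  · filter_upwards [eventually_ne_atTop 0] with n hn
    have hl : log (2 * (n : ℝ)) = log 2 + log n := log_mul two_ne_zero (by exact_mod_cast hn)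
    rw [integral_one_sub_cos_div]
    simp only [Function.comp_apply]
    push_cast
    rw [hl]
    ring
  · rw [h4]
    congr 1
    ring

lemma integral_mul_sin_two_pi_mul {k : ℕ} (hk : k ≠ 0) :
    ∫ x in (0 : ℝ)..1, x * sin (2 * k * π * x) = -1 / (2 * k * π) := by
  have hc : 2 * (k : ℝ) * π ≠ 0 := by positivity
  set c := 2 * (k : ℝ) * π with hcdef
  have hcos : cos c = 1 := by rw [hcdef, ← cos_nat_mul_two_pi k]; ring_nf
  have hsin : sin c = 0 := by rw [hcdef, ← sin_nat_mul_pi (2 * k)]; push_cast; ring_nf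
  rw [intervalIntegral.integral_eq_sub_of_hasDerivAt
    (f := fun x => sin (c * x) / c ^ 2 - x * cos (c * x) / c)]
  · simp [hcos, hsin, neg_div]
  · intro x _
    have h := (hasDerivAt_id x).const_mul c
    refine ((h.sin.div_const (c ^ 2)).sub
      (((hasDerivAt_id x).mul h.cos).div_const c)).congr_deriv ?_
    simp only [id]
    field_simp
    ring
  · exact Continuous.intervalIntegrable (by fun_prop) _ _

lemma integral_sin_two_pi_mul {k : ℕ} (hk : k ≠ 0) :
    ∫ x in (0 : ℝ)..1, sin (2 * k * π * x) = 0 := by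
  have hc : 2 * (k : ℝ) * π ≠ 0 := by positivity
  have hcos : cos (2 * (k : ℝ) * π) = 1 := by rw [← cos_nat_mul_two_pi k]; ring_nf
  rw [intervalIntegral.integral_comp_mul_left (fun x => sin x) hc]
  simp [integral_sin, hcos]

lemma sin_two_pi_mul_add_nat (k m : ℕ) (x : ℝ) :
    sin (2 * k * π * (x + m)) = sin (2 * k * π * x) := by
  rw [← sin_add_nat_mul_two_pi (2 * k * π * x) (k * m)]
  push_cast
  ring_nf

lemma intervalIntegrable_log_add_mul_sin (k m : ℕ) :
    IntervalIntegrable (fun x => log (x + m) * sin (2 * k * π * x)) volume 0 1 := by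
  have h := (intervalIntegrable_log_mul_sin (2 * k * π) (0 + m) (1 + m)).comp_add_right (m : ℝ)
  simpa [sin_two_pi_mul_add_nat] using h

lemma sum_integral_log_add_mul_sin (k n : ℕ) :
    ∑ m ∈ Finset.range n, ∫ x in (0 : ℝ)..1, log (x + m) * sin (2 * k * π * x) =
      ∫ x in (0 : ℝ)..n, log x * sin (2 * k * π * x) := by
  have h := intervalIntegral.sum_integral_adjacent_intervals (μ := volume)
    (a := fun m : ℕ => (m : ℝ)) (n := n) fun m _ => intervalIntegrable_log_mul_sin (2 * k * π) m (m + 1 : ℕ)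
  rw [Nat.cast_zero] at h
  rw [← h]
  refine Finset.sum_congr rfl fun m _ => ?_
  have h' := intervalIntegral.integral_comp_add_right (a := 0) (b := 1)
    (fun x => log x * sin (2 * k * π * x)) (m : ℝ)
  simp only [sin_two_pi_mul_add_nat] at h'
  rw [h', zero_add, Nat.cast_succ, add_comm 1]

lemma integral_log_mul_sin_two_pi_mul {k n : ℕ} (hk : k ≠ 0) (hn : n ≠ 0) :
    ∫ x in (0 : ℝ)..n, log x * sin (2 * k * π * x) =
      -(∫ t in (0 : ℝ)..(π / 2), (1 - cos (2 * (2 * k * n : ℕ) * t)) / t) / (2 * k * π) := by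
  have hn' : (n : ℝ) ≠ 0 := by exact_mod_cast hn
  have hcos : cos (2 * k * π * n) = 1 := by
    rw [← cos_nat_mul_two_pi (k * n)]; push_cast; ring_nf
  rw [integral_log_mul_sin (by positivity) n.cast_nonneg, hcos, sub_self, mul_zero, zero_sub]
  congr 2
  have h := intervalIntegral.mul_integral_comp_mul_left (a := 0) (b := π / 2)
    (f := fun x => (1 - cos (2 * k * π * x)) / x) (c := n * (2 / π))
  have he : (n : ℝ) * (2 / π) * (π / 2) = n := by field_simp
  rw [mul_zero, he] at h
  rw [← h, ← intervalIntegral.integral_const_mul]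
  congr 1 with t
  have hc : 2 * k * π * (n * (2 / π) * t) = 2 * (2 * k * n : ℕ) * t := by
    push_cast; field_simp
  rw [hc]
  field_simp

section LogGammaSeq
open BohrMollerup

lemma intervalIntegrable_logGammaSeq_mul_sin (k n : ℕ) :
    IntervalIntegrable (fun x => logGammaSeq x n * sin (2 * k * π * x)) volume 0 1 := by
  have h1 : IntervalIntegrable
      (fun x => (x * log n + log n.factorial) * sin (2 * k * π * x)) volume 0 1 :=
    Continuous.intervalIntegrable (by fun_prop) _ _
  have h2 := IntervalIntegrable.sum (Finset.range (n + 1))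
    fun m _ => intervalIntegrable_log_add_mul_sin k m
  refine (h1.sub h2).congr fun x _ => ?_
  simp [logGammaSeq, sub_mul, Finset.sum_mul]

lemma integral_logGammaSeq_mul_sin {k : ℕ} (hk : k ≠ 0) (n : ℕ) :
    ∫ x in (0 : ℝ)..1, logGammaSeq x n * sin (2 * k * π * x) =
      ((∫ t in (0 : ℝ)..(π / 2), (1 - cos (2 * (2 * k * (n + 1) : ℕ) * t)) / t) - log n) /
        (2 * k * π) := by
  have hx : IntervalIntegrable (fun x => log n * (x * sin (2 * k * π * x))) volume 0 1 :=
    Continuous.intervalIntegrable (by fun_prop) _ _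
  have hs : IntervalIntegrable (fun x => log n.factorial * sin (2 * k * π * x)) volume 0 1 :=
    Continuous.intervalIntegrable (by fun_prop) _ _
  have hl := fun m (_ : m ∈ Finset.range (n + 1)) => intervalIntegrable_log_add_mul_sin k m
  have hsum : IntervalIntegrable
      (fun x => ∑ m ∈ Finset.range (n + 1), log (x + m) * sin (2 * k * π * x)) volume 0 1 := by
    simpa [Finset.sum_fn] using IntervalIntegrable.sum (Finset.range (n + 1)) hl
  have he : (fun x => logGammaSeq x n * sin (2 * k * π * x)) = fun x =>
      log n * (x * sin (2 * k * π * x)) + log n.factorial * sin (2 * k * π * x) -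
        ∑ m ∈ Finset.range (n + 1), log (x + m) * sin (2 * k * π * x) := by
    funext x
    rw [logGammaSeq, sub_mul, Finset.sum_mul]
    ring
  rw [he, intervalIntegral.integral_sub (hx.add hs) hsum, intervalIntegral.integral_add hx hs,
    intervalIntegral.integral_const_mul, intervalIntegral.integral_const_mul,
    intervalIntegral.integral_finsetSum hl, sum_integral_log_add_mul_sin,
    integral_mul_sin_two_pi_mul hk, integral_sin_two_pi_mul hk,
    integral_log_mul_sin_two_pi_mul hk n.succ_ne_zero]
  ring

lemma abs_log_Gamma_sub_logGammaSeq_le {x : ℝ} {n : ℕ} (hx : x ∈ Ioc 0 1) (hn : n ≠ 0) :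
    |log (Gamma x) - logGammaSeq x n| ≤ log (n + 1) - log n := by
  have hfeq : ∀ {y : ℝ}, 0 < y → (log ∘ Gamma) (y + 1) = (log ∘ Gamma) y + log y := fun hy => by
    simp only [Function.comp_apply]
    rw [Gamma_add_one hy.ne', log_mul hy.ne' (Gamma_pos_of_pos hy).ne', add_comm]
  have h1 := le_logGammaSeq convexOn_log_Gamma hfeq hx.1 hx.2 n
  have h2 := ge_logGammaSeq convexOn_log_Gamma hfeq hx.1 hn
  simp only [Function.comp_apply, Gamma_one, log_one, zero_add] at h1 h2
  have hn' : (0 : ℝ) < n := by exact_mod_cast Nat.pos_of_ne_zero hn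
  have h3 : 0 ≤ log (n + 1) - log (n : ℝ) := sub_nonneg.2 (log_le_log hn' (by linarith))
  rw [abs_of_nonneg (by linarith)]
  nlinarith [hx.2]

lemma intervalIntegrable_log_Gamma : IntervalIntegrable (fun x => log (Gamma x)) volume 0 1 := by
  have h1 : IntervalIntegrable (fun x => log (Gamma (x + 1))) volume 0 1 := by
    refine ContinuousOn.intervalIntegrable fun x hx => ContinuousAt.continuousWithinAt ?_
    rw [uIcc_of_le zero_le_one] at hx
    have hx1 : 0 < x + 1 := by linarith [hx.1]
    have hG : ContinuousAt Gamma (x + 1) :=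
      (differentiableAt_Gamma fun m => by
        have := m.cast_nonneg (α := ℝ)
        exact ne_of_gt (by linarith)).continuousAt
    exact (ContinuousAt.comp (f := fun x : ℝ => x + 1) hG (by fun_prop)).log
      (Gamma_pos_of_pos hx1).ne'
  refine (h1.sub intervalIntegral.intervalIntegrable_log').congr fun x hx => ?_
  rw [uIoc_of_le zero_le_one] at hx
  rw [Gamma_add_one hx.1.ne', log_mul hx.1.ne' (Gamma_pos_of_pos hx.1).ne']
  ring

lemma tendsto_integral_logGammaSeq_mul_sin (k : ℕ) :
    Tendsto (fun n => ∫ x in (0 : ℝ)..1, logGammaSeq x n * sin (2 * k * π * x)) atTop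
      (𝓝 (∫ x in (0 : ℝ)..1, log (Gamma x) * sin (2 * k * π * x))) := by
  have h0 := (tendsto_log_comp_add_sub_log 1).comp (tendsto_natCast_atTop_atTop (R := ℝ))
  refine tendsto_iff_norm_sub_tendsto_zero.2
    (squeeze_zero' (.of_forall fun _ => norm_nonneg _) ?_ h0)
  filter_upwards [eventually_ne_atTop 0] with n hn
  rw [norm_sub_rev, ← intervalIntegral.integral_sub
    (intervalIntegrable_log_Gamma.mul_continuousOn (by fun_prop))
    (intervalIntegrable_logGammaSeq_mul_sin k n)]
  refine (intervalIntegral.norm_integral_le_of_norm_le_const (C := log (n + 1) - log n)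
    fun x hx => ?_).trans_eq (by simp)
  rw [uIoc_of_le zero_le_one] at hx
  rw [← sub_mul, norm_mul]
  exact (mul_le_of_le_one_right (norm_nonneg _) (abs_sin_le_one _)).trans
    (abs_log_Gamma_sub_logGammaSeq_le hx hn)

end LogGammaSeq

/-- For every positive integer `k`,
`∫_0^1 log Γ(x) sin(2kπx) dx = (γ + log(2kπ))/(2kπ)`. -/
theorem integral_log_Gamma_mul_sin (k : ℕ) (hk : 1 ≤ k) :
    ∫ x in (0:ℝ)..1, Real.log (Real.Gamma x) * Real.sin (2 * (k : ℝ) * Real.pi * x) =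
      (Real.eulerMascheroniConstant + Real.log (2 * (k : ℝ) * Real.pi)) /
        (2 * (k : ℝ) * Real.pi) := by
  have hk0 : k ≠ 0 := by lia
  have hk' : 2 * (k : ℝ) ≠ 0 := by positivity
  have hM : Tendsto (fun n : ℕ => 2 * k * (n + 1)) atTop atTop :=
    (tendsto_add_atTop_nat 1).const_mul_atTop' (by lia)
  have hQ := tendsto_integral_one_sub_cos_div_sub_log.comp hM
  have hlog := (tendsto_log_comp_add_sub_log 1).comp (tendsto_natCast_atTop_atTop (R := ℝ))
  have h := ((hQ.add hlog).add_const (log (2 * k))).div_const (2 * k * π)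
  refine tendsto_nhds_unique (tendsto_integral_logGammaSeq_mul_sin k)
    ((h.congr fun n => ?_).trans_eq ?_)
  · rw [integral_logGammaSeq_mul_sin hk0]
    have hl : log ((2 * k * (n + 1) : ℕ) : ℝ) = log (2 * k) + log (n + 1) := by
      push_cast
      exact log_mul hk' (by positivity)
    simp only [Function.comp_apply]
    rw [hl]
    ring
  · rw [log_mul hk' pi_ne_zero]
    congr 2
    ring
end

section
/- Kummer's Fourier series: for every real x with 0 < x < 1, log Γ(x) = (1/2) log π − (1/2) log sin(πx) + ∑_{n=1}^∞ (γ + log(2πn)) sin(2πnx)/(πn), in the sense that the partial sums of the series converge to log Γ(x) − (1/2) log π + (1/2) log sin(πx). -/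
open Filter Topology Finset

/-- **Abel's inequality**: summation by parts bounds a sum with nonnegative decreasing weights. -/
theorem Antitone.norm_sum_range_smul_le {E : Type*} [NormedAddCommGroup E] [NormedSpace ℝ E]
    {b : ℕ → ℝ} (hb : Antitone b) (hb0 : ∀ n, 0 ≤ b n) {a : ℕ → E} {C : ℝ}
    (ha : ∀ n, ‖∑ i ∈ range n, a i‖ ≤ C) (n : ℕ) :
    ‖∑ i ∈ range n, b i • a i‖ ≤ b 0 * C := by
  rw [Finset.sum_range_by_parts]
  calc _ ≤ b (n - 1) * C + ∑ i ∈ range (n - 1), (b i - b (i + 1)) * C := by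
        refine (norm_sub_le _ _).trans (add_le_add ?_ ((norm_sum_le _ _).trans ?_))
        · rw [norm_smul, Real.norm_of_nonneg (hb0 _)]
          exact mul_le_mul_of_nonneg_left (ha n) (hb0 _)
        · refine Finset.sum_le_sum fun i _ ↦ ?_
          rw [norm_smul, Real.norm_of_nonpos (sub_nonpos.2 (hb i.le_succ)), neg_sub]
          exact mul_le_mul_of_nonneg_left (ha _) (sub_nonneg.2 (hb i.le_succ))
    _ = b 0 * C := by
        rw [← Finset.sum_mul, Finset.sum_range_sub']
        ring

/-- **Abel's theorem** for Dirichlet series, along the real axis. -/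
theorem tendsto_dirichletSeries_nhdsGT_zero {E : Type*} [NormedAddCommGroup E] [NormedSpace ℝ E]
    {a : ℕ → E} {L : E} (hL : Tendsto (fun N ↦ ∑ n ∈ range N, a n) atTop (𝓝 L)) {Q : ℝ → E}
    (hQ : ∀ ε > 0, HasSum (fun n : ℕ ↦ ((n : ℝ) + 1) ^ (-ε) • a n) (Q ε)) :
    Tendsto Q (𝓝[>] 0) (𝓝 L) := by
  rw [Metric.tendsto_nhds]
  intro η hη
  obtain ⟨M₁, hM₁⟩ := Metric.cauchySeq_iff.1 hL.cauchySeq (η / 3) (by positivity)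
  obtain ⟨M₂, hM₂⟩ := Metric.tendsto_atTop.1 hL (η / 3) (by positivity)
  set M := max M₁ M₂
  have hcont : Tendsto (fun ε : ℝ ↦ ∑ n ∈ range M, ((n : ℝ) + 1) ^ (-ε) • a n) (𝓝[>] 0)
      (𝓝 (∑ n ∈ range M, a n)) := by
    have h : Continuous fun ε : ℝ ↦ ∑ n ∈ range M, ((n : ℝ) + 1) ^ (-ε) • a n :=
      continuous_finsetSum _ fun n _ ↦
        (Real.continuous_const_rpow (by positivity)).comp continuous_neg |>.smul continuous_const
    simpa using (h.tendsto 0).mono_left nhdsWithin_le_nhds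
  filter_upwards [Metric.tendsto_nhds.1 hcont (η / 3) (by positivity), self_mem_nhdsWithin]
    with ε h₁ hε
  have hε : 0 < ε := hε
  have hanti : Antitone fun i : ℕ ↦ (((i + M : ℕ) : ℝ) + 1) ^ (-ε) := fun i j hij ↦
    Real.rpow_le_rpow_of_nonpos (by positivity) (by gcongr) (by linarith)
  have htail (N : ℕ) : ‖∑ i ∈ range N, (((i + M : ℕ) : ℝ) + 1) ^ (-ε) • a (i + M)‖ ≤ η / 3 := by
    refine (hanti.norm_sum_range_smul_le (fun _ ↦ by positivity) (C := η / 3) (fun n ↦ ?_) N).trans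
      (mul_le_of_le_one_left (by positivity) ?_)
    · have := hM₁ (n + M) (by omega) M (by omega)
      rw [dist_eq_norm, add_comm n M, Finset.sum_range_add_sub_sum_range] at this
      simpa [add_comm] using this.le
    · exact Real.rpow_le_one_of_one_le_of_nonpos (by simp) (by linarith)
  have h₂ : dist (Q ε) (∑ n ∈ range M, ((n : ℝ) + 1) ^ (-ε) • a n) ≤ η / 3 := by
    rw [dist_eq_norm]
    exact le_of_tendsto' ((hasSum_nat_add_iff' M).2 (hQ ε hε)).tendsto_sum_nat.norm htail
  have h₃ := hM₂ M (by omega)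
  linarith [dist_triangle4 (Q ε) (∑ n ∈ range M, ((n : ℝ) + 1) ^ (-ε) • a n)
    (∑ n ∈ range M, a n) L]

/-- The partial sums of `∑ sin (2πnx)` are bounded when `x` is not an integer. -/
theorem exists_abs_sum_sin_le {x : ℝ} (hx0 : 0 < x) (hx1 : x < 1) :
    ∃ C, ∀ N : ℕ, ‖∑ n ∈ range N, Real.sin (2 * Real.pi * ((n : ℝ) + 1) * x)‖ ≤ C := by
  set w := Complex.exp (↑(2 * Real.pi * x) * Complex.I) with hw
  have hw1 : w ≠ 1 := by
    rw [hw, Ne, Complex.exp_eq_one_iff]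
    rintro ⟨n, hn⟩
    have h : (x : ℂ) = n := by
      have : (2 * Real.pi * Complex.I : ℂ) ≠ 0 := Complex.two_pi_I_ne_zero
      apply mul_right_cancel₀ this
      rw [← hn]; push_cast; ring
    have h' : x = n := by exact_mod_cast h
    rw [h'] at hx0 hx1
    norm_cast at hx0 hx1
    omega
  have hnorm : ‖w‖ = 1 := Complex.norm_exp_ofReal_mul_I _
  refine ⟨2 / ‖w - 1‖, fun N ↦ ?_⟩
  have hsum : ∑ n ∈ range N, Real.sin (2 * Real.pi * ((n : ℝ) + 1) * x)
      = (w * ∑ n ∈ range N, w ^ n).im := by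
    rw [Finset.mul_sum, Complex.im_sum]
    refine Finset.sum_congr rfl fun n _ ↦ ?_
    rw [← pow_succ', hw, ← Complex.exp_nat_mul, ← Complex.exp_ofReal_mul_I_im]
    congr 2
    push_cast
    ring
  rw [hsum, geom_sum_eq hw1]
  refine (Complex.abs_im_le_norm _).trans ?_
  rw [norm_mul, hnorm, one_mul, norm_div]
  gcongr
  refine (norm_sub_le _ _).trans ?_
  rw [norm_pow, hnorm]
  norm_num

/-- The partial sums of Kummer's series converge. -/
theorem exists_tendsto_kummer_series {x : ℝ} (hx0 : 0 < x) (hx1 : x < 1) :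
    ∃ L, Tendsto (fun N : ℕ ↦ ∑ n ∈ range N,
      (Real.eulerMascheroniConstant + Real.log (2 * Real.pi * ((n : ℝ) + 1))) *
        Real.sin (2 * Real.pi * ((n : ℝ) + 1) * x) / (Real.pi * ((n : ℝ) + 1))) atTop (𝓝 L) := by
  obtain ⟨C, hC⟩ := exists_abs_sum_sin_le hx0 hx1
  set K := Real.exp Real.eulerMascheroniConstant * (2 * Real.pi) with hK
  have hKpos : 0 < K := by positivity
  have hγ : 0 < Real.eulerMascheroniConstant := by
    linarith [Real.one_half_lt_eulerMascheroniConstant]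
  have hKe : Real.exp 1 ≤ K := by
    have h₁ : 1 ≤ Real.exp Real.eulerMascheroniConstant := Real.one_le_exp hγ.le
    nlinarith [Real.pi_gt_three, Real.exp_one_lt_d9]
  have hterm (n : ℕ) : Real.eulerMascheroniConstant + Real.log (2 * Real.pi * ((n : ℝ) + 1))
      = Real.log (K * ((n : ℝ) + 1)) := by
    rw [hK, mul_assoc (Real.exp _), Real.log_mul (Real.exp_ne_zero _) (by positivity), Real.log_exp]
  set f : ℕ → ℝ := fun n ↦
    K / Real.pi * (Real.log (K * ((n : ℝ) + 1)) / (K * ((n : ℝ) + 1))) with hf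
  have hanti : Antitone f := fun m n hmn ↦ by
    have hmem (k : ℕ) : K * ((k : ℝ) + 1) ∈ Set.Ici (Real.exp 1) := by
      have : (0 : ℝ) ≤ k := by positivity
      exact hKe.trans (by nlinarith)
    refine mul_le_mul_of_nonneg_left
      (Real.log_div_self_antitoneOn (hmem m) (hmem n) ?_) (by positivity)
    gcongr
  have hzero : Tendsto f atTop (𝓝 0) := by
    have h₁ : Tendsto (fun n : ℕ ↦ K * ((n : ℝ) + 1)) atTop atTop :=
      (tendsto_natCast_atTop_atTop.atTop_add tendsto_const_nhds).const_mul_atTop hKpos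
    have h₂ : Tendsto (fun y : ℝ ↦ Real.log y / y) atTop (𝓝 0) :=
      Real.isLittleO_log_id_atTop.tendsto_div_nhds_zero
    simpa [hf] using (h₂.comp h₁).const_mul (K / Real.pi)
  obtain ⟨L, hL⟩ := cauchySeq_tendsto_of_complete
    (hanti.cauchySeq_series_mul_of_tendsto_zero_of_bounded hzero hC)
  refine ⟨L, hL.congr fun N ↦ Finset.sum_congr rfl fun n _ ↦ ?_⟩
  rw [hterm, hf, smul_eq_mul]
  field_simp

theorem hasDerivAt_ofReal_cpow_const_of_pos {y : ℝ} (hy : 0 < y) (w : ℂ) :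
    HasDerivAt (fun y : ℝ ↦ (y : ℂ) ^ w) (w * (y : ℂ) ^ (w - 1)) y := by
  have h := ((hasDerivAt_id (y : ℂ)).cpow_const (c := w) (Or.inl (by simpa using hy))).comp_ofReal
  simpa using h

/-- Mean value bound for `y ↦ y ^ w` to the right of a positive point. -/
theorem norm_ofReal_cpow_sub_le {m : ℝ} (hm : 0 < m) {w : ℂ} (hw : w.re ≤ 1) {a b : ℝ}
    (ha : m ≤ a) (hb : m ≤ b) :
    ‖(a : ℂ) ^ w - (b : ℂ) ^ w‖ ≤ ‖w‖ * m ^ (w.re - 1) * |a - b| := by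
  refine Convex.norm_image_sub_le_of_norm_hasDerivWithin_le (s := Set.Ici m)
    (fun y hy ↦ (hasDerivAt_ofReal_cpow_const_of_pos (hm.trans_le hy) w).hasDerivWithinAt)
    (fun y hy ↦ ?_) (convex_Ici m) hb ha
  rw [norm_mul, Complex.norm_cpow_eq_rpow_re_of_pos (hm.trans_le hy), Complex.sub_re,
    Complex.one_re]
  gcongr ‖w‖ * ?_
  exact Real.rpow_le_rpow_of_nonpos hm hy (by linarith)

/-- A second order mean value bound for `y ↦ y ^ (-s)`. -/
theorem norm_ofReal_cpow_neg_sub_add_le {m : ℝ} (hm : 0 < m) {s : ℂ} (hs : -1 ≤ s.re)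
    {a b c : ℝ} (ha : a ∈ Set.Icc m (m + 2)) (hb : b ∈ Set.Icc m (m + 2))
    (hc : c ∈ Set.Icc m (m + 2)) :
    ‖((a : ℂ) ^ (-s) + s * (c : ℂ) ^ (-s - 1) * a) - ((b : ℂ) ^ (-s) + s * (c : ℂ) ^ (-s - 1) * b)‖
      ≤ 2 * (‖s‖ * ‖s + 1‖ * m ^ (-s.re - 2)) * |a - b| := by
  refine Convex.norm_image_sub_le_of_norm_hasDerivWithin_le (s := Set.Icc m (m + 2))
    (f := fun y : ℝ ↦ (y : ℂ) ^ (-s) + s * (c : ℂ) ^ (-s - 1) * y)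
    (f' := fun y ↦ -s * (y : ℂ) ^ (-s - 1) + s * (c : ℂ) ^ (-s - 1) * 1)
    (fun y hy ↦ ((hasDerivAt_ofReal_cpow_const_of_pos (hm.trans_le hy.1) (-s)).add
      ((hasDerivAt_id (y : ℝ)).ofReal_comp.const_mul _)).hasDerivWithinAt)
    (fun y hy ↦ ?_) (convex_Icc m _) hb ha
  have h : ‖(c : ℂ) ^ (-s - 1) - (y : ℂ) ^ (-s - 1)‖ ≤
      ‖-s - 1‖ * m ^ ((-s - 1).re - 1) * |c - y| :=
    norm_ofReal_cpow_sub_le hm (by simp; linarith) hc.1 hy.1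
  have hcy : |c - y| ≤ 2 := abs_le.2 ⟨by linarith [hc.1, hy.2], by linarith [hc.2, hy.1]⟩
  have hnorm : ‖-s - 1‖ = ‖s + 1‖ := by rw [← norm_neg]; congr 1; ring
  have hre : (-s - 1).re - 1 = -s.re - 2 := by simp; ring
  rw [hnorm, hre] at h
  calc _ = ‖s‖ * ‖(c : ℂ) ^ (-s - 1) - (y : ℂ) ^ (-s - 1)‖ := by
        rw [← norm_mul]; congr 1; ring
    _ ≤ ‖s‖ * (‖s + 1‖ * m ^ (-s.re - 2) * 2) := by gcongr; exact h.trans (by gcongr)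
    _ = _ := by ring

/-- Terms of a series continuing `2 * hurwitzZetaOdd x s - (1 - 2 * x)` to the half-plane
`-1 < re s`. -/
noncomputable def hurwitzZetaOddTerm (x : ℝ) (n : ℕ) (s : ℂ) : ℂ :=
  ((n + x : ℝ) : ℂ) ^ (-s) - ((n + 1 - x : ℝ) : ℂ) ^ (-s)
    - (1 - 2 * x : ℝ) * (((n + 1 : ℝ) : ℂ) ^ (-s) - ((n + 2 : ℝ) : ℂ) ^ (-s))

theorem norm_hurwitzZetaOddTerm_le {x δ : ℝ} (hδ : 0 < δ) (hx0 : δ ≤ x) (hx1 : δ ≤ 1 - x) (n : ℕ)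
    {s : ℂ} (hs : -1 / 2 ≤ s.re) (hs' : ‖s‖ ≤ 3) :
    ‖hurwitzZetaOddTerm x n s‖ ≤ 48 * δ ^ (-5 : ℝ) * ((n : ℝ) + 1) ^ (-(3 / 2) : ℝ) := by
  have hn : (0 : ℝ) ≤ n := n.cast_nonneg
  have hm : 0 < (n : ℝ) + δ := by positivity
  have hre : s.re ≤ 3 := (Complex.re_le_norm s).trans hs'
  have hs1 : ‖s + 1‖ ≤ 4 := (norm_add_le _ _).trans (by rw [norm_one]; linarith)
  set c : ℝ := n + 1
  have hc : c ∈ Set.Icc ((n : ℝ) + δ) (n + δ + 2) := ⟨by grind, by grind⟩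
  have h₁ := norm_ofReal_cpow_neg_sub_add_le hm (s := s) (by linarith) (a := n + x)
    (b := n + 1 - x) ⟨by linarith, by linarith⟩ ⟨by linarith, by linarith⟩ hc
  have h₂ := norm_ofReal_cpow_neg_sub_add_le hm (s := s) (by linarith) (a := n + 1)
    (b := n + 2) ⟨by linarith, by linarith⟩ ⟨by linarith, by linarith⟩ hc
  have hx : |1 - 2 * x| ≤ 1 := abs_le.2 ⟨by linarith, by linarith⟩
  have hpow : ((n : ℝ) + δ) ^ (-s.re - 2) ≤ δ ^ (-5 : ℝ) * ((n : ℝ) + 1) ^ (-(3 / 2) : ℝ) := by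
    calc _ ≤ (δ * ((n : ℝ) + 1)) ^ (-s.re - 2) :=
          Real.rpow_le_rpow_of_nonpos (by positivity) (by nlinarith) (by linarith)
      _ = δ ^ (-s.re - 2) * ((n : ℝ) + 1) ^ (-s.re - 2) :=
          Real.mul_rpow hδ.le (by positivity)
      _ ≤ _ := by
          gcongr ?_ * ?_
          · exact Real.rpow_le_rpow_of_exponent_ge hδ (by linarith) (by linarith)
          · exact Real.rpow_le_rpow_of_exponent_le (by linarith) (by linarith)
  have hB : 2 * (‖s‖ * ‖s + 1‖ * ((n : ℝ) + δ) ^ (-s.re - 2)) ≤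
      24 * (δ ^ (-5 : ℝ) * ((n : ℝ) + 1) ^ (-(3 / 2) : ℝ)) :=
    calc _ ≤ 2 * (3 * 4 * (δ ^ (-5 : ℝ) * ((n : ℝ) + 1) ^ (-(3 / 2) : ℝ))) := by gcongr
      _ = _ := by ring
  set B := 24 * (δ ^ (-5 : ℝ) * ((n : ℝ) + 1) ^ (-(3 / 2) : ℝ))
  have hB0 : 0 ≤ B := by positivity
  have h₁' := h₁.trans (mul_le_mul hB
    (show |(n : ℝ) + x - (n + 1 - x)| ≤ 1 from abs_le.2 ⟨by linarith, by linarith⟩)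
    (abs_nonneg _) hB0)
  have h₂' := h₂.trans (mul_le_mul hB
    (show |(n : ℝ) + 1 - (n + 2)| ≤ 1 from abs_le.2 ⟨by linarith, by linarith⟩)
    (abs_nonneg _) hB0)
  have hdecomp : hurwitzZetaOddTerm x n s =
      ((((n + x : ℝ) : ℂ) ^ (-s) + s * (c : ℂ) ^ (-s - 1) * (n + x : ℝ))
        - (((n + 1 - x : ℝ) : ℂ) ^ (-s) + s * (c : ℂ) ^ (-s - 1) * (n + 1 - x : ℝ)))
      - (1 - 2 * x : ℝ) * ((((n + 1 : ℝ) : ℂ) ^ (-s) + s * (c : ℂ) ^ (-s - 1) * (n + 1 : ℝ))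
        - (((n + 2 : ℝ) : ℂ) ^ (-s) + s * (c : ℂ) ^ (-s - 1) * (n + 2 : ℝ))) := by
    rw [hurwitzZetaOddTerm]
    push_cast
    ring
  rw [hdecomp]
  refine (norm_sub_le _ _).trans ?_
  rw [norm_mul, Complex.norm_real, Real.norm_eq_abs]
  have h₃ := mul_le_mul hx h₂' (norm_nonneg _) zero_le_one
  calc _ ≤ B * 1 + 1 * (B * 1) := add_le_add h₁' h₃
    _ = _ := by ring

theorem hasDerivAt_ofReal_cpow_neg {y : ℝ} (hy : 0 < y) (s : ℂ) :
    HasDerivAt (fun s : ℂ ↦ (y : ℂ) ^ (-s)) (-((y : ℂ) ^ (-s) * Real.log y)) s := by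
  simpa [Complex.ofReal_log hy.le] using
    (hasDerivAt_neg s).const_cpow (c := (y : ℂ)) (Or.inl (by exact_mod_cast hy.ne'))

theorem differentiable_hurwitzZetaOddTerm {x : ℝ} (hx0 : 0 < x) (hx1 : x < 1) (n : ℕ) :
    Differentiable ℂ (hurwitzZetaOddTerm x n) := by
  have hn : (0 : ℝ) ≤ n := n.cast_nonneg
  have h {y : ℝ} (hy : 0 < y) : Differentiable ℂ fun s : ℂ ↦ (y : ℂ) ^ (-s) :=
    fun s ↦ (hasDerivAt_ofReal_cpow_neg hy s).differentiableAt
  exact ((h (by linarith)).sub (h (by linarith))).sub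
    (((h (by linarith)).sub (h (by linarith))).const_mul _)

theorem deriv_hurwitzZetaOddTerm_zero {x : ℝ} (hx0 : 0 < x) (hx1 : x < 1) (n : ℕ) :
    deriv (hurwitzZetaOddTerm x n) 0 =
      ((Real.log (n + 1 - x) - Real.log (x + n)
        - (1 - 2 * x) * (Real.log (n + 2) - Real.log (n + 1)) : ℝ) : ℂ) := by
  have hn : (0 : ℝ) ≤ n := n.cast_nonneg
  have h {y : ℝ} (hy : 0 < y) := hasDerivAt_ofReal_cpow_neg hy 0
  have := ((h (y := n + x) (by linarith)).sub (h (y := n + 1 - x) (by linarith))).sub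
    (((h (y := n + 1) (by linarith)).sub (h (y := n + 2) (by linarith))).const_mul
      ((1 - 2 * x : ℝ) : ℂ))
  refine this.deriv.trans ?_
  simp only [neg_zero, Complex.cpow_zero, one_mul]
  rw [add_comm x]
  push_cast
  ring

/-- In the half-plane `1 < re s`, the series of `hurwitzZetaOddTerm` telescopes. -/
theorem hasSum_hurwitzZetaOddTerm {x : ℝ} (hx0 : 0 < x) (hx1 : x < 1) {s : ℂ} (hs : 1 < s.re)
    (hsum : Summable fun n ↦ hurwitzZetaOddTerm x n s) :
    HasSum (fun n ↦ hurwitzZetaOddTerm x n s)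
      (2 * HurwitzZeta.hurwitzZetaOdd x s - (1 - 2 * x)) := by
  have h := ((HurwitzZeta.hasSum_nat_hurwitzZetaOdd_of_mem_Icc ⟨hx0.le, hx1.le⟩
    hs).tendsto_sum_nat).const_mul 2
  have hpow : Tendsto (fun N : ℕ ↦ ((N + 1 : ℝ) : ℂ) ^ (-s)) atTop (𝓝 0) := by
    rw [tendsto_zero_iff_norm_tendsto_zero]
    have h₁ : Tendsto (fun N : ℕ ↦ (N : ℝ) + 1) atTop atTop :=
      tendsto_natCast_atTop_atTop.atTop_add tendsto_const_nhds
    refine ((tendsto_rpow_neg_atTop (y := s.re) (by linarith)).comp h₁).congr fun N ↦ ?_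
    rw [Complex.norm_cpow_eq_rpow_re_of_pos (by positivity)]
    simp
  have hlim := h.sub ((hpow.const_sub 1).const_mul ((1 - 2 * x : ℝ) : ℂ))
  have heq : Tendsto (fun N ↦ ∑ n ∈ range N, hurwitzZetaOddTerm x n s) atTop
      (𝓝 (2 * HurwitzZeta.hurwitzZetaOdd x s - ((1 - 2 * x : ℝ) : ℂ) * (1 - 0))) := by
    refine hlim.congr fun N ↦ ?_
    have htel : ∑ n ∈ range N, (((n + 1 : ℝ) : ℂ) ^ (-s) - ((n + 2 : ℝ) : ℂ) ^ (-s))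
        = 1 - ((N + 1 : ℝ) : ℂ) ^ (-s) := by
      have := Finset.sum_range_sub' (fun n : ℕ ↦ ((n + 1 : ℝ) : ℂ) ^ (-s)) N
      simp only [Nat.cast_zero, zero_add, Complex.ofReal_one, Complex.one_cpow] at this
      rw [← this]
      refine Finset.sum_congr rfl fun n _ ↦ ?_
      push_cast
      ring_nf
    simp only [hurwitzZetaOddTerm]
    rw [Finset.sum_sub_distrib, ← Finset.mul_sum, htel, Finset.mul_sum]
    congr 1
    refine Finset.sum_congr rfl fun n _ ↦ ?_
    simp only [Complex.cpow_neg]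
    push_cast
    ring
  have := tendsto_nhds_unique hsum.hasSum.tendsto_sum_nat heq
  convert! hsum.hasSum using 1
  rw [this]
  push_cast
  ring

/-- The derivative at `0` of the odd Hurwitz zeta function (Lerch's formula). -/
theorem deriv_hurwitzZetaOdd_zero {x : ℝ} (hx0 : 0 < x) (hx1 : x < 1) :
    deriv (HurwitzZeta.hurwitzZetaOdd x) 0 =
      (((Real.log (Real.Gamma x) - Real.log (Real.Gamma (1 - x))) / 2 : ℝ) : ℂ) := by
  set U : Set ℂ := {s | -1 / 2 < s.re} ∩ Metric.ball 0 3
  set δ := min x (1 - x)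
  have hδ : 0 < δ := lt_min hx0 (by linarith)
  have hUo : IsOpen U := (isOpen_lt continuous_const Complex.continuous_re).inter Metric.isOpen_ball
  have hUc : IsPreconnected U :=
    ((convex_halfSpace_re_gt _).inter (convex_ball _ _)).isPreconnected
  have h0U : (0 : ℂ) ∈ U := ⟨by norm_num, by simp⟩
  have h2U : (2 : ℂ) ∈ U := ⟨by simp; norm_num, by simp; norm_num⟩
  have hu : Summable fun n : ℕ ↦ 48 * δ ^ (-5 : ℝ) * ((n : ℝ) + 1) ^ (-(3 / 2) : ℝ) := by
    have : Summable fun n : ℕ ↦ (n : ℝ) ^ (-(3 / 2) : ℝ) :=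
      Real.summable_nat_rpow.2 (by norm_num)
    simpa using ((summable_nat_add_iff 1).2 this).mul_left (48 * δ ^ (-5 : ℝ))
  have hle (n : ℕ) (s : ℂ) (hs : s ∈ U) := norm_hurwitzZetaOddTerm_le hδ (min_le_left _ _)
    (min_le_right _ _) n (s := s) (le_of_lt hs.1) (by simpa using (Metric.mem_ball.1 hs.2).le)
  have hd (n : ℕ) : DifferentiableOn ℂ (hurwitzZetaOddTerm x n) U :=
    (differentiable_hurwitzZetaOddTerm hx0 hx1 n).differentiableOn
  have hdiff := Complex.differentiableOn_tsum_of_summable_norm hu hd hUo hle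
  have hodd := HurwitzZeta.differentiable_hurwitzZetaOdd x
  have hev : (fun s ↦ ∑' n, hurwitzZetaOddTerm x n s) =ᶠ[𝓝 2]
      fun s ↦ 2 * HurwitzZeta.hurwitzZetaOdd x s - (1 - 2 * x) := by
    have : ∀ᶠ s : ℂ in 𝓝 2, 1 < s.re :=
      (isOpen_lt continuous_const Complex.continuous_re).mem_nhds (by simp)
    filter_upwards [this, hUo.mem_nhds h2U] with s hs hsU
    exact (hasSum_hurwitzZetaOddTerm hx0 hx1 hs
      (Summable.of_norm_bounded hu fun n ↦ hle n s hsU)).tsum_eq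
  have heq := (hdiff.analyticOnNhd hUo).eqOn_of_preconnected_of_eventuallyEq
    (((hodd.const_mul 2).sub_const _).differentiableOn.analyticOnNhd hUo) hUc h2U hev
  have hsum := Complex.hasSum_deriv_of_summable_norm hu hd hUo hle h0U
  rw [(heq.eventuallyEq_of_mem (hUo.mem_nhds h0U)).deriv_eq, deriv_sub_const,
    deriv_const_mul _ (hodd 0)] at hsum
  simp only [deriv_hurwitzZetaOddTerm_zero hx0 hx1] at hsum
  have hlim := (tendsto_add_atTop_iff_nat 1).2 hsum.tendsto_sum_nat
  have hΓ := (Real.BohrMollerup.tendsto_log_gamma hx0).sub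
    (Real.BohrMollerup.tendsto_log_gamma (x := 1 - x) (by linarith))
  have hlog := ((Real.tendsto_log_comp_add_sub_log 2).comp tendsto_natCast_atTop_atTop).const_mul
    (1 - 2 * x)
  have hreal := hΓ.sub hlog
  have hcomplex := (Complex.continuous_ofReal.tendsto _).comp hreal
  have := tendsto_nhds_unique hlim (hcomplex.congr fun N ↦ ?_)
  · rw [mul_zero, sub_zero] at this
    push_cast at this ⊢
    rw [← this]
    ring
  · have htel := Finset.sum_range_sub (fun n : ℕ ↦ Real.log ((n : ℝ) + 1)) (N + 1)
    rw [Function.comp_apply, ← Complex.ofReal_sum]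
    congr 1
    rw [Finset.sum_sub_distrib, Finset.sum_sub_distrib, ← Finset.mul_sum]
    have h₁ : ∑ n ∈ range (N + 1), (Real.log ((n : ℝ) + 2) - Real.log (n + 1))
        = Real.log (N + 2) := by
      simp only [Nat.cast_zero, zero_add, Real.log_one, sub_zero] at htel
      have e : ((N + 1 : ℕ) : ℝ) + 1 = N + 2 := by push_cast; ring
      rw [← e, ← htel]
      refine Finset.sum_congr rfl fun n _ ↦ ?_
      push_cast
      ring_nf
    have h₂ : ∑ n ∈ range (N + 1), Real.log ((n : ℝ) + 1 - x)
        = ∑ n ∈ range (N + 1), Real.log (1 - x + n) :=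
      Finset.sum_congr rfl fun n _ ↦ by ring_nf
    rw [h₁, h₂, Real.BohrMollerup.logGammaSeq, Real.BohrMollerup.logGammaSeq]
    simp only [Function.comp_apply]
    ring

/-- The functional equation relates the derivative of the odd Hurwitz zeta function at `0` to the
sine zeta function at `1`. -/
theorem deriv_hurwitzZetaOdd_zero_eq_sinZeta (a : UnitAddCircle) :
    deriv (HurwitzZeta.hurwitzZetaOdd a) 0 =
      ((Real.eulerMascheroniConstant + Real.log (2 * Real.pi) : ℝ) * HurwitzZeta.sinZeta a 1
        - deriv (HurwitzZeta.sinZeta a) 1) / Real.pi := by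
  have hleft : HasDerivAt (fun s ↦ HurwitzZeta.hurwitzZetaOdd a (1 - s))
      (-deriv (HurwitzZeta.hurwitzZetaOdd a) 0) 1 := by
    have h : HasDerivAt (HurwitzZeta.hurwitzZetaOdd a) (deriv (HurwitzZeta.hurwitzZetaOdd a) 0)
        (1 - 1) := by
      rw [sub_self]
      exact (HurwitzZeta.differentiable_hurwitzZetaOdd a 0).hasDerivAt
    simpa [Function.comp_def] using h.comp (1 : ℂ) ((hasDerivAt_id (1 : ℂ)).const_sub 1)
  have hsin : HasDerivAt (fun s : ℂ ↦ Complex.sin (Real.pi * s / 2)) 0 1 := by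
    have h := (((hasDerivAt_id (1 : ℂ)).const_mul (Real.pi : ℂ)).div_const 2).csin
    simpa [Complex.cos_pi_div_two] using h
  have hright := (Complex.hasDerivAt_Gammaℂ_one.mul hsin).mul
    (HurwitzZeta.differentiableAt_sinZeta a 1).hasDerivAt
  have heq : (fun s ↦ HurwitzZeta.hurwitzZetaOdd a (1 - s)) =ᶠ[𝓝 1]
      (Complex.Gammaℂ * fun s : ℂ ↦ Complex.sin (Real.pi * s / 2)) * HurwitzZeta.sinZeta a := by
    have : ∀ᶠ s : ℂ in 𝓝 1, 0 < s.re :=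
      (isOpen_lt continuous_const Complex.continuous_re).mem_nhds (by simp)
    filter_upwards [this] with s hs
    rw [HurwitzZeta.hurwitzZetaOdd_one_sub a fun n hn ↦ ?_]
    · rfl
    · rw [hn, Complex.neg_re, Complex.natCast_re] at hs
      linarith [n.cast_nonneg (α := ℝ)]
  have h := hleft.unique (hright.congr_of_eventuallyEq heq)
  have hΓ : Complex.Gammaℂ 1 = 1 / Real.pi := by
    rw [Complex.Gammaℂ_def, Complex.Gamma_one, Complex.cpow_neg_one]
    field_simp
  rw [← neg_inj, h]
  simp only [Pi.mul_apply, hΓ, mul_one, Complex.sin_pi_div_two, Complex.ofReal_log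
    Real.two_pi_pos.le, Complex.ofReal_add, Complex.ofReal_mul, Complex.ofReal_ofNat]
  ring

/-- Kummer's series, weighted by powers of the index, in terms of the sine zeta function. -/
theorem hasSum_kummer_series {x s : ℝ} (hs : 1 < s) :
    HasSum (fun n : ℕ ↦
      (((Real.eulerMascheroniConstant + Real.log (2 * Real.pi * ((n : ℝ) + 1))) *
        Real.sin (2 * Real.pi * ((n : ℝ) + 1) * x) / Real.pi * ((n : ℝ) + 1) ^ (-s) : ℝ) : ℂ))
      (((Real.eulerMascheroniConstant + Real.log (2 * Real.pi) : ℝ) * HurwitzZeta.sinZeta x s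
        - deriv (HurwitzZeta.sinZeta x) s) / Real.pi) := by
  set f : ℕ → ℂ := fun n ↦ Real.sin (2 * Real.pi * x * n)
  have hs' : 1 < (s : ℂ).re := by simpa
  have habs : LSeries.abscissaOfAbsConv f < (s : ℂ).re := by
    refine lt_of_le_of_lt (LSeries.abscissaOfAbsConv_le_of_forall_lt_LSeriesSummable (x := 1)
      fun y hy ↦ ?_) (by exact_mod_cast hs')
    exact (HurwitzZeta.LSeriesHasSum_sin x (s := y) (by simpa)).LSeriesSummable
  have hderiv : deriv (HurwitzZeta.sinZeta x) s = -LSeries (LSeries.logMul f) s := by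
    rw [← LSeries_deriv habs]
    refine Filter.EventuallyEq.deriv_eq ?_
    filter_upwards [(isOpen_lt continuous_const Complex.continuous_re).mem_nhds hs'] with z hz
    exact (HurwitzZeta.LSeriesHasSum_sin x hz).LSeries_eq.symm
  have h₁ := HurwitzZeta.LSeriesHasSum_sin x hs'
  have h₂ := (LSeriesSummable_logMul_of_lt_re habs).LSeriesHasSum
  have h := ((h₁.mul_left
    ((Real.eulerMascheroniConstant + Real.log (2 * Real.pi) : ℝ) : ℂ)).add h₂).div_const
      (Real.pi : ℂ)
  rw [hderiv, sub_neg_eq_add]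
  have h' := (hasSum_nat_add_iff' 1).2 h
  simp only [Finset.sum_range_one, LSeries.term_zero, mul_zero, add_zero, zero_div, sub_zero] at h'
  refine h'.congr_fun fun n ↦ ?_
  have hn : (0 : ℝ) < n + 1 := by positivity
  rw [LSeries.term_of_ne_zero n.succ_ne_zero, LSeries.term_of_ne_zero n.succ_ne_zero,
    LSeries.logMul, Real.log_mul (by positivity) hn.ne', Real.rpow_neg hn.le]
  have hcast : ((n + 1 : ℕ) : ℂ) = ((n + 1 : ℝ) : ℂ) := by push_cast; rfl
  have harg : 2 * Real.pi * x * ((n + 1 : ℕ) : ℝ) = 2 * Real.pi * (n + 1) * x := by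
    push_cast; ring
  simp only [f, harg, hcast, ← Complex.ofReal_log hn.le, ← Complex.ofReal_cpow hn.le]
  norm_cast
  field_simp
  ring


/-- Kummer's Fourier series: for `0 < x < 1`, the partial sums of
`∑_{n=1}^∞ (γ + log(2πn)) sin(2πnx)/(πn)` converge to
`log Γ(x) − (1/2) log π + (1/2) log sin(πx)`. -/
theorem kummer_fourier_log_Gamma (x : ℝ) (hx0 : 0 < x) (hx1 : x < 1) :
    Filter.Tendsto (fun N : ℕ =>
        ∑ n ∈ Finset.Icc 1 N,
          (Real.eulerMascheroniConstant + Real.log (2 * Real.pi * (n : ℝ))) *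
            Real.sin (2 * Real.pi * (n : ℝ) * x) / (Real.pi * (n : ℝ)))
      Filter.atTop
      (nhds (Real.log (Real.Gamma x) - (1 / 2) * Real.log Real.pi +
        (1 / 2) * Real.log (Real.sin (Real.pi * x)))) := by
  obtain ⟨L, hL⟩ := exists_tendsto_kummer_series hx0 hx1
  set a : ℕ → ℝ := fun n ↦
    (Real.eulerMascheroniConstant + Real.log (2 * Real.pi * ((n : ℝ) + 1))) *
      Real.sin (2 * Real.pi * ((n : ℝ) + 1) * x) / (Real.pi * ((n : ℝ) + 1)) with ha
  have hAbel : Tendsto (fun ε : ℝ ↦ ((Real.eulerMascheroniConstant + Real.log (2 * Real.pi) : ℝ) *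
      HurwitzZeta.sinZeta x ((1 + ε : ℝ) : ℂ)
        - deriv (HurwitzZeta.sinZeta x) ((1 + ε : ℝ) : ℂ)) / Real.pi) (𝓝[>] 0) (𝓝 (L : ℂ)) := by
    refine tendsto_dirichletSeries_nhdsGT_zero (a := fun n ↦ (a n : ℂ)) ?_ fun ε hε ↦ ?_
    · exact_mod_cast (Complex.continuous_ofReal.tendsto L).comp hL
    · refine (hasSum_kummer_series (x := x) (s := 1 + ε) (by linarith)).congr_fun fun n ↦ ?_
      rw [Complex.real_smul, ← Complex.ofReal_mul, ha]
      congr 1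
      have hn : (0 : ℝ) < n + 1 := by positivity
      rw [neg_add, Real.rpow_add hn, Real.rpow_neg_one]
      field_simp
  have hcont : Tendsto (fun ε : ℝ ↦ ((Real.eulerMascheroniConstant + Real.log (2 * Real.pi) : ℝ) *
      HurwitzZeta.sinZeta x ((1 + ε : ℝ) : ℂ)
        - deriv (HurwitzZeta.sinZeta x) ((1 + ε : ℝ) : ℂ)) / Real.pi) (𝓝[>] 0)
      (𝓝 (deriv (HurwitzZeta.hurwitzZetaOdd x) 0)) := by
    have hd := HurwitzZeta.differentiableAt_sinZeta x
    have hc : Continuous fun ε : ℝ ↦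
        ((Real.eulerMascheroniConstant + Real.log (2 * Real.pi) : ℝ) *
          HurwitzZeta.sinZeta x ((1 + ε : ℝ) : ℂ)
            - deriv (HurwitzZeta.sinZeta x) ((1 + ε : ℝ) : ℂ)) / Real.pi := by
      have h₁ := hd.continuous
      have h₂ := (hd.contDiff (n := 1)).continuous_deriv le_rfl
      fun_prop
    rw [deriv_hurwitzZetaOdd_zero_eq_sinZeta]
    simpa using (hc.tendsto 0).mono_left nhdsWithin_le_nhds
  have hval := tendsto_nhds_unique hAbel hcont
  rw [deriv_hurwitzZetaOdd_zero hx0 hx1, Complex.ofReal_inj] at hval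
  have hrefl : Real.log (Real.Gamma x) + Real.log (Real.Gamma (1 - x)) =
      Real.log Real.pi - Real.log (Real.sin (Real.pi * x)) := by
    have hs : 0 < Real.sin (Real.pi * x) :=
      Real.sin_pos_of_pos_of_lt_pi (by positivity) (by nlinarith [Real.pi_pos])
    rw [← Real.log_mul (Real.Gamma_pos_of_pos hx0).ne'
      (Real.Gamma_pos_of_pos (by linarith)).ne', Real.Gamma_mul_Gamma_one_sub,
      Real.log_div Real.pi_ne_zero hs.ne']
  have hgoal : Real.log (Real.Gamma x) - (1 / 2) * Real.log Real.pi +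
      (1 / 2) * Real.log (Real.sin (Real.pi * x)) = L := by
    rw [hval]; linarith
  rw [hgoal]
  refine hL.congr fun N ↦ ?_
  rw [Finset.range_eq_Ico, ← Finset.Ico_add_one_right_eq_Icc,
    ← Finset.sum_Ico_add' _ 0 N 1]
  exact Finset.sum_congr rfl fun n _ ↦ by simp [ha]
end
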